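/- Let $N \in \{5,6,7\}$ and set $q = N^2 - 14N + 52$. Let $G : [0,\infty) \to [0,\infty)$ be a nondecreasing measurable function such that $G(s)/s^{q+1} \to +\infty$ as $s \to +\infty$. Then for all constants $c > 0$ and $r_0 > 0$, $$\lim_{\varepsilon \to 0^+} \; \varepsilon^{-1} \int_{B(0,r_0)} G\left( \frac{c\, \varepsilon^{\frac{N-4}{2}}}{(\varepsilon^2 + |x|^2)^{\frac{N-4}{2}}} \right) \mathrm{d}x \;=\; +\infty,$$ where the integral is taken over the Euclidean ball $B(0,r_0) \subset \mathbb{R}^N$ with respect to Lebesgue measure. -/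

import Mathlib

open Filter Topology MeasureTheory

/-- The value of the Talenti function `c ε^a / (ε² + |x|²)^a` at `|x| = ε`. -/
lemma talenti_diagonal (a c ε : ℝ) (hε : 0 < ε) :
    c * ε ^ a / (ε ^ 2 + ε ^ 2) ^ a = c / 2 ^ a * ε ^ (-a) := by
  rw [show ε ^ 2 + ε ^ 2 = 2 * (ε * ε) by ring, Real.mul_rpow (by norm_num) (by positivity),
    Real.mul_rpow hε.le hε.le, Real.rpow_neg hε.le]
  have := Real.rpow_pos_of_pos hε a
  have := Real.rpow_pos_of_pos (zero_lt_two (α := ℝ)) a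
  field_simp

lemma talenti_antitone {a c ε s t : ℝ} (ha : 0 ≤ a) (hc : 0 ≤ c) (hε : 0 < ε)
    (hs : 0 ≤ s) (hst : s ≤ t) :
    c * ε ^ a / (ε ^ 2 + t ^ 2) ^ a ≤ c * ε ^ a / (ε ^ 2 + s ^ 2) ^ a := by
  gcongr

/-- Restricting the integral to the ball of radius `ε` bounds it below by the value of the
integrand on the boundary times the volume of that ball. -/
lemma mul_le_integral_talenti {N : ℕ} {G : ℝ → ℝ} (hG0 : ∀ s : ℝ, 0 ≤ s → 0 ≤ G s)
    (hmono : MonotoneOn G (Set.Ici 0)) (hmeas : Measurable G) {a c r₀ ε : ℝ} (ha : 0 ≤ a)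
    (hc : 0 ≤ c) (hε : 0 < ε) (hεr : ε ≤ r₀) :
    G (c / 2 ^ a * ε ^ (-a)) *
        (ε ^ N * volume.real (Metric.ball (0 : EuclideanSpace ℝ (Fin N)) 1)) ≤
      ∫ x in Metric.ball (0 : EuclideanSpace ℝ (Fin N)) r₀,
        G (c * ε ^ a / (ε ^ 2 + ‖x‖ ^ 2) ^ a) := by
  have hpos (t : ℝ) : 0 ≤ c * ε ^ a / (ε ^ 2 + t ^ 2) ^ a := by positivity
  have hint : IntegrableOn (fun x : EuclideanSpace ℝ (Fin N) ↦
      G (c * ε ^ a / (ε ^ 2 + ‖x‖ ^ 2) ^ a)) (Metric.ball 0 r₀) := by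
    refine Measure.integrableOn_of_bounded (M := G (c * ε ^ a / (ε ^ 2 + 0 ^ 2) ^ a))
      measure_ball_lt_top.ne ?_ ?_
    · exact (hmeas.comp (by fun_prop)).aestronglyMeasurable
    · refine .of_forall fun x ↦ ?_
      rw [Real.norm_of_nonneg (hG0 _ (hpos _))]
      exact hmono (hpos _) (hpos _) (talenti_antitone ha hc hε le_rfl (norm_nonneg x))
  have hvol : volume.real (Metric.ball (0 : EuclideanSpace ℝ (Fin N)) ε) =
      ε ^ N * volume.real (Metric.ball (0 : EuclideanSpace ℝ (Fin N)) 1) := by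
    simp [measureReal_def, Measure.addHaar_ball_of_pos _ _ hε, ENNReal.toReal_mul, hε.le]
  rw [← talenti_diagonal a c ε hε, ← hvol]
  refine (setIntegral_ge_of_const_le_real measurableSet_ball measure_ball_lt_top.ne ?_
    (hint.mono_set (Metric.ball_subset_ball hεr))).trans
    (setIntegral_mono_set hint (.of_forall fun x ↦ hG0 _ (hpos _))
      (Metric.ball_subset_ball hεr).eventuallyLE)
  intro x hx
  exact hmono (hpos _) (hpos _) (talenti_antitone ha hc hε (norm_nonneg x)
    (mem_ball_zero_iff.1 hx).le)

/-- The key Talenti-function estimate: for `N ∈ {5,6,7}` and `q = N² - 14N + 52`, if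
`G` is nondecreasing with `G(s)/s^{q+1} → ∞`, then
`ε⁻¹ ∫_{B(0,r₀)} G(c ε^{(N-4)/2} / (ε² + |x|²)^{(N-4)/2}) dx → +∞` as `ε → 0⁺`. -/
theorem stmt11 (N : ℕ) (hN : N = 5 ∨ N = 6 ∨ N = 7)
    (q : ℝ) (hq : q = (N : ℝ) ^ 2 - 14 * N + 52)
    (G : ℝ → ℝ) (hG0 : ∀ s : ℝ, 0 ≤ s → 0 ≤ G s)
    (hmono : MonotoneOn G (Set.Ici 0)) (hmeas : Measurable G)
    (hgrow : Tendsto (fun s : ℝ => G s / s ^ (q + 1)) atTop atTop)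
    (c r₀ : ℝ) (hc : 0 < c) (hr : 0 < r₀) :
    Tendsto (fun ε : ℝ =>
        ε⁻¹ * ∫ x in Metric.ball (0 : EuclideanSpace ℝ (Fin N)) r₀,
          G (c * ε ^ (((N : ℝ) - 4) / 2) / (ε ^ 2 + ‖x‖ ^ 2) ^ (((N : ℝ) - 4) / 2)))
      (𝓝[>] (0 : ℝ)) atTop := by
  have ha : 0 < ((N : ℝ) - 4) / 2 := by rcases hN with rfl | rfl | rfl <;> norm_num
  have haq : ((N : ℝ) - 4) / 2 * (q + 1) = N - 1 := by
    rcases hN with rfl | rfl | rfl <;> norm_num [hq]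
  generalize ((N : ℝ) - 4) / 2 = a at ha haq ⊢
  set k : ℝ := c / 2 ^ a
  have hk : 0 < k := by positivity
  set V : ℝ := volume.real (Metric.ball (0 : EuclideanSpace ℝ (Fin N)) 1)
  have hV : 0 < V := ENNReal.toReal_pos (Metric.measure_ball_pos _ _ one_pos).ne'
    measure_ball_lt_top.ne
  have hlim : Tendsto (fun ε : ℝ ↦ k * ε ^ (-a)) (𝓝[>] 0) atTop :=
    (tendsto_rpow_neg_nhdsGT_zero (neg_neg_of_pos ha)).const_mul_atTop hk
  refine tendsto_atTop_mono' _ ?_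
    ((hgrow.comp hlim).const_mul_atTop (show 0 < k ^ (q + 1) * V by positivity))
  filter_upwards [Ioo_mem_nhdsGT hr] with ε ⟨hε, hεr⟩
  refine le_trans (le_of_eq ?_) (mul_le_mul_of_nonneg_left
    (mul_le_integral_talenti hG0 hmono hmeas ha.le hc.le hε hεr.le) (inv_nonneg.2 hε.le))
  have hpow : (k * ε ^ (-a)) ^ (q + 1) = k ^ (q + 1) * (ε * (ε ^ N)⁻¹) := by
    rw [Real.mul_rpow hk.le (by positivity), ← Real.rpow_mul hε.le,
      show -a * (q + 1) = 1 - N by linarith, Real.rpow_sub hε, Real.rpow_one,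
      Real.rpow_natCast, div_eq_mul_inv]
  have := Real.rpow_pos_of_pos hk (q + 1)
  simp only [Function.comp_apply, hpow]
  change _ = ε⁻¹ * (G (k * ε ^ (-a)) * (ε ^ N * V))
  field_simp
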